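/- Fix k₀ > 0 and σ₀ > 0, and define σ(z)² := σ₀² + z²/(4 k₀² σ₀²). Define on ℝ² × ℝ the functions ρ(x,y,z) := (1/(2π σ(z)²)) exp(−(x²+y²)/(2σ(z)²)) and φ(x,y,z) := (k₀ z / (2(z² + 4 k₀² σ₀⁴)))(x² + y²) − arctan(z/(2 k₀ σ₀²)). Then (ρ, φ) is an exact solution of the Madelung system: ∂_z ρ + (1/k₀) div(ρ ∇φ) = 0 and k₀ ∂_z φ + ½|∇φ|² = ½ Δ√ρ/√ρ, where ∇, div, Δ are in (x,y). -/

import Mathlib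

open MeasureTheory

noncomputable section

/-- Partial derivative in the first (x) variable of a function of (x, y, z). -/
def dX (f : ℝ → ℝ → ℝ → ℝ) (x y z : ℝ) : ℝ := deriv (fun t => f t y z) x

/-- Partial derivative in the second (y) variable of a function of (x, y, z). -/
def dY (f : ℝ → ℝ → ℝ → ℝ) (x y z : ℝ) : ℝ := deriv (fun t => f x t z) y

/-- Partial derivative in the third (z, propagation) variable. -/
def dZ (f : ℝ → ℝ → ℝ → ℝ) (x y z : ℝ) : ℝ := deriv (fun t => f x y t) z

/-- The quantum pressure `Q(ρ) = Δ√ρ / √ρ`. -/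
def Qp (ρ : ℝ → ℝ → ℝ → ℝ) (x y z : ℝ) : ℝ :=
  (dX (dX (fun a b c => Real.sqrt (ρ a b c))) x y z
    + dY (dY (fun a b c => Real.sqrt (ρ a b c))) x y z) / Real.sqrt (ρ x y z)

/-- The spreading width `σ(z)² = σ₀² + z²/(4 k₀² σ₀²)`. -/
def σsq (k₀ σ₀ z : ℝ) : ℝ := σ₀ ^ 2 + z ^ 2 / (4 * k₀ ^ 2 * σ₀ ^ 2)

/-- The Gaussian intensity `ρ(x,y,z) = (1/(2π σ(z)²)) exp(−(x²+y²)/(2σ(z)²))`. -/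
def ρG (k₀ σ₀ : ℝ) : ℝ → ℝ → ℝ → ℝ := fun x y z =>
  (1 / (2 * Real.pi * σsq k₀ σ₀ z)) * Real.exp (-(x ^ 2 + y ^ 2) / (2 * σsq k₀ σ₀ z))

/-- The phase `φ(x,y,z) = (k₀ z / (2(z² + 4 k₀² σ₀⁴)))(x² + y²) − arctan(z/(2 k₀ σ₀²))`. -/
def φG (k₀ σ₀ : ℝ) : ℝ → ℝ → ℝ → ℝ := fun x y z =>
  (k₀ * z / (2 * (z ^ 2 + 4 * k₀ ^ 2 * σ₀ ^ 4))) * (x ^ 2 + y ^ 2)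
    - Real.arctan (z / (2 * k₀ * σ₀ ^ 2))

lemma aux_sigma_pos (k s z : ℝ) (hs : 0 < s) : 0 < σsq k s z := by
  unfold σsq; positivity

lemma aux_sigma_deriv (k s z : ℝ) :
    HasDerivAt (fun t => σsq k s t) (2 * z / (4 * k ^ 2 * s ^ 2)) z := by
  unfold σsq
  have h := (((hasDerivAt_id z).pow 2).div_const (4 * k ^ 2 * s ^ 2)).const_add (s ^ 2)
  refine HasDerivAt.congr_deriv h ?_
  simp

/-- derivative of a one-variable Gaussian -/
lemma aux_gauss (C b q x : ℝ) :
    HasDerivAt (fun t : ℝ => C * Real.exp (-(t ^ 2 + b) / q))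
      (C * Real.exp (-(x ^ 2 + b) / q) * (-(2 * x) / q)) x := by
  have h := (((((hasDerivAt_id x).pow 2).add_const b).neg.div_const q).exp).const_mul C
  refine HasDerivAt.congr_deriv h ?_
  simp
  ring

lemma aux_gauss_mul (C b q a x : ℝ) :
    HasDerivAt (fun t : ℝ => C * Real.exp (-(t ^ 2 + b) / q) * (a * t))
      (C * Real.exp (-(x ^ 2 + b) / q) * (a - 2 * a * x ^ 2 / q)) x := by
  have h := (aux_gauss C b q x).mul ((hasDerivAt_id x).const_mul a)
  refine HasDerivAt.congr_deriv h ?_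
  simp
  ring

lemma aux_quad (A b c x : ℝ) :
    HasDerivAt (fun t : ℝ => A * (t ^ 2 + b) - c) (2 * A * x) x := by
  have h := ((((hasDerivAt_id x).pow 2).add_const b).const_mul A).sub_const c
  refine HasDerivAt.congr_deriv h ?_
  simp
  ring

lemma aux_dX_phi (k s x y z : ℝ) : dX (φG k s) x y z
    = 2 * (k * z / (2 * (z ^ 2 + 4 * k ^ 2 * s ^ 4))) * x :=
  (aux_quad _ (y ^ 2) _ x).deriv

lemma aux_dY_phi (k s x y z : ℝ) : dY (φG k s) x y z
    = 2 * (k * z / (2 * (z ^ 2 + 4 * k ^ 2 * s ^ 4))) * y := by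
  have h := (aux_quad (k * z / (2 * (z ^ 2 + 4 * k ^ 2 * s ^ 4))) (x ^ 2)
    (Real.arctan (z / (2 * k * s ^ 2))) y).deriv
  rw [← h]
  simp only [dY, φG, add_comm]

lemma aux_dX_flux (k s x y z : ℝ) :
    dX (fun a b c => ρG k s a b c * dX (φG k s) a b c) x y z
    = ρG k s x y z * (2 * (k * z / (2 * (z ^ 2 + 4 * k ^ 2 * s ^ 4)))
      - 2 * (2 * (k * z / (2 * (z ^ 2 + 4 * k ^ 2 * s ^ 4)))) * x ^ 2 / (2 * σsq k s z)) := by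
  simp only [aux_dX_phi]
  exact (aux_gauss_mul _ (y ^ 2) _ _ x).deriv

lemma aux_rho_symm (k s x y z : ℝ) : ρG k s x y z = ρG k s y x z := by
  simp only [ρG, add_comm]

lemma aux_dY_flux (k s x y z : ℝ) :
    dY (fun a b c => ρG k s a b c * dY (φG k s) a b c) x y z
    = ρG k s x y z * (2 * (k * z / (2 * (z ^ 2 + 4 * k ^ 2 * s ^ 4)))
      - 2 * (2 * (k * z / (2 * (z ^ 2 + 4 * k ^ 2 * s ^ 4)))) * y ^ 2 / (2 * σsq k s z)) := by
  simp only [aux_dY_phi]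
  simp only [dY, aux_rho_symm k s x]
  exact (aux_gauss_mul _ (x ^ 2) _ _ y).deriv

lemma aux_sqrt (k s x y z : ℝ) (hs : 0 < s) : Real.sqrt (ρG k s x y z)
    = Real.sqrt (1 / (2 * Real.pi * σsq k s z)) *
      Real.exp (-(x ^ 2 + y ^ 2) / (4 * σsq k s z)) := by
  have hp := aux_sigma_pos k s z hs
  unfold ρG
  rw [Real.sqrt_mul (by positivity), ← Real.exp_half]
  congr 2
  field_simp
  ring

lemma aux_second (C b q x : ℝ) :
    deriv (fun u => deriv (fun t : ℝ => C * Real.exp (-(t ^ 2 + b) / q)) u) x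
      = C * Real.exp (-(x ^ 2 + b) / q) * (-2 / q + 4 * x ^ 2 / q ^ 2) := by
  have e : (fun u => deriv (fun t : ℝ => C * Real.exp (-(t ^ 2 + b) / q)) u)
      = fun u => C * Real.exp (-(u ^ 2 + b) / q) * ((-2 / q) * u) := by
    funext u
    rw [(aux_gauss C b q u).deriv]
    ring
  rw [e, (aux_gauss_mul C b q _ x).deriv]
  ring

lemma aux_Qp (k s x y z : ℝ) (hs : 0 < s) : Qp (ρG k s) x y z
    = (x ^ 2 + y ^ 2) / (4 * σsq k s z ^ 2) - 1 / σsq k s z := by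
  have hp := aux_sigma_pos k s z hs
  have hx := aux_second (Real.sqrt (1 / (2 * Real.pi * σsq k s z))) (y ^ 2) (4 * σsq k s z) x
  have hy := aux_second (Real.sqrt (1 / (2 * Real.pi * σsq k s z))) (x ^ 2) (4 * σsq k s z) y
  simp only [add_comm _ (x ^ 2)] at hy
  have hS : 0 < Real.sqrt (1 / (2 * Real.pi * σsq k s z)) *
      Real.exp (-(x ^ 2 + y ^ 2) / (4 * σsq k s z)) := by positivity
  simp only [Qp, dX, dY, aux_sqrt k s _ _ _ hs]
  rw [hx, hy, ← mul_add, mul_div_cancel_left₀ _ hS.ne']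
  field_simp
  ring

lemma aux_dZ_rho (k s x y z : ℝ) (hs : 0 < s) : dZ (ρG k s) x y z
    = ρG k s x y z * ((2 * z / (4 * k ^ 2 * s ^ 2)) *
      ((x ^ 2 + y ^ 2) / (2 * σsq k s z ^ 2) - 1 / σsq k s z)) := by
  have hp := aux_sigma_pos k s z hs
  have hd := aux_sigma_deriv k s z
  have h1 := (hasDerivAt_const z (1 : ℝ)).div (hd.const_mul (2 * Real.pi)) (by positivity)
  have h2 := ((hasDerivAt_const z (-(x ^ 2 + y ^ 2))).div (hd.const_mul 2) (by positivity)).exp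
  have h := (h1.mul h2).deriv
  refine Eq.trans h ?_
  simp only [ρG, Pi.div_apply]
  generalize 2 * z / (4 * k ^ 2 * s ^ 2) = w
  generalize Real.exp _ = E
  generalize σsq k s z = S at *
  field_simp
  ring

lemma aux_dZ_phi (k s x y z : ℝ) (hk : 0 < k) (hs : 0 < s) : dZ (φG k s) x y z
    = k * (4 * k ^ 2 * s ^ 4 - z ^ 2) / (2 * (z ^ 2 + 4 * k ^ 2 * s ^ 4) ^ 2) * (x ^ 2 + y ^ 2)
      - 2 * k * s ^ 2 / (z ^ 2 + 4 * k ^ 2 * s ^ 4) := by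
  have h0 : 0 < z ^ 2 + 4 * k ^ 2 * s ^ 4 := by positivity
  have h1 := (((hasDerivAt_id z).const_mul k).div
    ((((hasDerivAt_id z).pow 2).add_const (4 * k ^ 2 * s ^ 4)).const_mul 2)
      (by simp; positivity)).mul_const (x ^ 2 + y ^ 2)
  have h2 := ((hasDerivAt_id z).div_const (2 * k * s ^ 2)).arctan
  refine Eq.trans (h1.sub h2).deriv ?_
  simp
  have h3 : 1 + (z / (2 * k * s ^ 2)) ^ 2 = (z ^ 2 + 4 * k ^ 2 * s ^ 4) / (4 * k ^ 2 * s ^ 4) := by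
    field_simp
    ring
  rw [h3]
  field_simp
  ring

/-- **Exact Gaussian solution of the Madelung system.** For `k₀ > 0`, `σ₀ > 0`, the
pair `(ρG, φG)` satisfies the continuity equation `∂_z ρ + (1/k₀) div(ρ∇φ) = 0` and
the Hamilton–Jacobi equation `k₀ ∂_z φ + ½|∇φ|² = ½ Δ√ρ/√ρ` at every point of
`ℝ² × ℝ`. -/
theorem gaussian_solves_madelung (k₀ σ₀ : ℝ) (hk₀ : 0 < k₀) (hσ₀ : 0 < σ₀) :
    ∀ x y z : ℝ,
      (dZ (ρG k₀ σ₀) x y z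
        + (1 / k₀) *
          (dX (fun a b c => ρG k₀ σ₀ a b c * dX (φG k₀ σ₀) a b c) x y z
            + dY (fun a b c => ρG k₀ σ₀ a b c * dY (φG k₀ σ₀) a b c) x y z) = 0)
      ∧
      (k₀ * dZ (φG k₀ σ₀) x y z
        + (1 / 2) * ((dX (φG k₀ σ₀) x y z) ^ 2 + (dY (φG k₀ σ₀) x y z) ^ 2)
        = (1 / 2) * Qp (ρG k₀ σ₀) x y z) := by
  intro x y z
  have hp := aux_sigma_pos k₀ σ₀ z hσ₀
  have hD : z ^ 2 + 4 * k₀ ^ 2 * σ₀ ^ 4 = 4 * k₀ ^ 2 * σ₀ ^ 2 * σsq k₀ σ₀ z := by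
    unfold σsq
    field_simp
    ring
  constructor
  · rw [aux_dX_flux, aux_dY_flux, aux_dZ_rho _ _ _ _ _ hσ₀, hD]
    generalize ρG k₀ σ₀ x y z = R
    generalize σsq k₀ σ₀ z = S at *
    field_simp
    ring
  · rw [aux_Qp _ _ _ _ _ hσ₀, aux_dX_phi, aux_dY_phi, aux_dZ_phi _ _ _ _ _ hk₀ hσ₀, hD]
    have hz : z ^ 2 = 4 * k₀ ^ 2 * σ₀ ^ 2 * σsq k₀ σ₀ z - 4 * k₀ ^ 2 * σ₀ ^ 4 := by linarith
    generalize σsq k₀ σ₀ z = S at *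
    field_simp
    rw [hz]
    ring

end
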